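/- Let A ≥ 2, n, r, e be non-negative integers with 2e ≤ A(n+1) − 2, and set S = A if r ≥ n + 1 and S = 2A otherwise. Then the series Σ_{k_1 ≥ k_2 ≥ 1} ((k_1 + k_2 + n + r)(k_1 − k_2 + r))^e / ((k_1+r)_{n+1}^A (k_2)_{n+1}^A) converges and is a ℚ-linear combination of 1, the values ζ(s) with 2 ≤ s ≤ S, and: if e is even, the sums ζ(s, s') + ζ(s', s) with 2 ≤ s ≤ s' ≤ A and s' ≡ s ≡ A(n+1) (mod 2); if e is odd, the differences ζ(s, s') − ζ(s', s) with 2 ≤ s < s' ≤ A and s' ≡ s ≡ A(n+1) (mod 2). -/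

import Mathlib

/-- The value `ζ(s) = ∑_{k ≥ 1} 1/k^s` of the Riemann zeta function. -/
noncomputable def zv (s : ℕ) : ℝ := ∑' k : ℕ+, ((k : ℝ) ^ s)⁻¹

/-- The double zeta value `ζ(s, t) = ∑_{k₁ > k₂ ≥ 1} 1/(k₁^s k₂^t)`. -/
noncomputable def dzv (s t : ℕ) : ℝ :=
  ∑' k : {q : ℕ × ℕ // q.2 < q.1 ∧ 1 ≤ q.2},
    ((k.1.1 : ℝ) ^ s * (k.1.2 : ℝ) ^ t)⁻¹

open Filter Topology Polynomial

/-- The simple fraction `1 / (x + j)^s`, sampled at the positive integers `x = k + 1`. -/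
noncomputable def simpleFrac (j s : ℕ) : ℕ → ℝ := fun k => (((k : ℝ) + 1 + j) ^ s)⁻¹

/-- The rational span of the simple fractions with poles in `-J` of order at most `S`. -/
noncomputable def fracSpan (J : Set ℕ) (S : ℕ) : Submodule ℚ (ℕ → ℝ) :=
  Submodule.span ℚ {f | ∃ j ∈ J, ∃ s, 1 ≤ s ∧ s ≤ S ∧ f = simpleFrac j s}

/-- The rational span of `1` and of the zeta values `ζ(s)`, `2 ≤ s ≤ S`. -/
noncomputable def zetaSpan (S : ℕ) : Submodule ℚ ℝ :=
  Submodule.span ℚ ({1} ∪ {x | ∃ s, 2 ≤ s ∧ s ≤ S ∧ x = zv s})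

/-- The tail `∑_{k > N} 1 / k^s` of the series for `ζ(s)`. -/
noncomputable def zetaTail (s N : ℕ) : ℝ := ∑' a : ℕ, (((a : ℝ) + N + 1) ^ s)⁻¹

/-- `f k` is `O(1/(k+1)^m)`, uniformly in `k`. -/
def DecaysLike (m : ℕ) (f : ℕ → ℝ) : Prop := ∃ C : ℝ, ∀ k : ℕ, |f k| ≤ C * (((k : ℝ) + 1) ^ m)⁻¹

theorem simpleFrac_mem {J : Set ℕ} {S j s : ℕ} (hj : j ∈ J) (h1 : 1 ≤ s) (h2 : s ≤ S) :
    simpleFrac j s ∈ fracSpan J S :=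
  Submodule.subset_span ⟨j, hj, s, h1, h2, rfl⟩

theorem fracSpan_induction {J : Set ℕ} {S : ℕ} {p : (f : ℕ → ℝ) → f ∈ fracSpan J S → Prop}
    (mem : ∀ j (hj : j ∈ J) s (h1 : 1 ≤ s) (h2 : s ≤ S),
      p (simpleFrac j s) (simpleFrac_mem hj h1 h2))
    (zero : p 0 (Submodule.zero_mem _))
    (add : ∀ f g hf hg, p f hf → p g hg → p (f + g) (Submodule.add_mem _ hf hg))
    (smul : ∀ (q : ℚ) f hf, p f hf → p (q • f) (Submodule.smul_mem _ q hf))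
    {f : ℕ → ℝ} (hf : f ∈ fracSpan J S) : p f hf := by
  induction hf using Submodule.span_induction with
  | mem f hf => obtain ⟨j, hj, s, h1, h2, rfl⟩ := hf; exact mem j hj s h1 h2
  | zero => exact zero
  | add f g hf' hg' hf hg => exact add f g hf' hg' hf hg
  | smul q f hf' hf => exact smul q f hf' hf

theorem fracSpan_shift {J J' : Set ℕ} {S r : ℕ} (h : ∀ j ∈ J, j + r ∈ J') {f : ℕ → ℝ}
    (hf : f ∈ fracSpan J S) : (fun k => f (k + r)) ∈ fracSpan J' S := by
  induction hf using fracSpan_induction with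
  | mem j hj s h1 h2 =>
    convert simpleFrac_mem (h j hj) h1 h2 using 1
    ext k
    simp only [simpleFrac]
    push_cast
    ring_nf
  | zero => exact Submodule.zero_mem _
  | add f g _ _ hf hg => exact Submodule.add_mem _ hf hg
  | smul q f _ hf => exact Submodule.smul_mem _ q hf

theorem fracSpan_apply_rat {J : Set ℕ} {S : ℕ} {f : ℕ → ℝ} (hf : f ∈ fracSpan J S) (k : ℕ) :
    ∃ q : ℚ, f k = q := by
  induction hf using fracSpan_induction with
  | mem j hj s h1 h2 => exact ⟨(((k : ℚ) + 1 + j) ^ s)⁻¹, by simp [simpleFrac]⟩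
  | zero => exact ⟨0, by simp⟩
  | add f g _ _ hf hg =>
    obtain ⟨a, ha⟩ := hf
    obtain ⟨b, hb⟩ := hg
    exact ⟨a + b, by simp [ha, hb]⟩
  | smul q f _ hf =>
    obtain ⟨a, ha⟩ := hf
    exact ⟨q * a, by simp [ha, Rat.smul_def]⟩

theorem fracSpan_tendsto {J : Set ℕ} {S : ℕ} {f : ℕ → ℝ} (hf : f ∈ fracSpan J S) :
    ∃ L : ℝ, Tendsto (fun k : ℕ => ((k : ℝ) + 1) * f k) atTop (𝓝 L) := by
  induction hf using fracSpan_induction with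
  | mem j hj s h1 h2 =>
    have hx : Tendsto (fun k : ℕ => (k : ℝ) + 1 + j) atTop atTop :=
      tendsto_atTop_add_const_right _ _
        (tendsto_atTop_add_const_right _ _ tendsto_natCast_atTop_atTop)
    have hq : Tendsto (fun k : ℕ => ((k : ℝ) + 1) * ((k : ℝ) + 1 + j)⁻¹) atTop (𝓝 1) := by
      have h := (hx.inv_tendsto_atTop.const_mul (j : ℝ)).const_sub 1
      simp only [mul_zero, sub_zero] at h
      refine h.congr fun k => ?_
      have : (k : ℝ) + 1 + j ≠ 0 := by positivity
      simp only [Pi.inv_apply]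
      field_simp
      ring
    obtain ⟨L, hL⟩ : ∃ L : ℝ,
        Tendsto (fun k : ℕ => (((k : ℝ) + 1 + j) ^ (s - 1))⁻¹) atTop (𝓝 L) := by
      rcases Nat.eq_zero_or_pos (s - 1) with h0 | h0
      · exact ⟨1, by simp [h0]⟩
      · exact ⟨0, ((tendsto_pow_atTop h0.ne').comp hx).inv_tendsto_atTop⟩
    refine ⟨1 * L, (hq.mul hL).congr fun k => ?_⟩
    obtain ⟨s, rfl⟩ := Nat.exists_eq_add_of_le' h1
    simp only [simpleFrac, Nat.add_sub_cancel, pow_succ, mul_inv]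
    ring
  | zero => exact ⟨0, by simp⟩
  | add f g _ _ hf hg =>
    obtain ⟨a, ha⟩ := hf
    obtain ⟨b, hb⟩ := hg
    exact ⟨a + b, (ha.add hb).congr fun k => by simp [mul_add]⟩
  | smul q f _ hf =>
    obtain ⟨a, ha⟩ := hf
    exact ⟨q * a, (ha.const_mul (q : ℝ)).congr fun k => by simp [Rat.smul_def]; ring⟩

theorem fracSpan_tendsto_zero {J : Set ℕ} {S : ℕ} {f : ℕ → ℝ} (hf : f ∈ fracSpan J S) :
    Tendsto f atTop (𝓝 0) := by
  obtain ⟨L, hL⟩ := fracSpan_tendsto hf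
  have h := hL.mul (tendsto_one_div_add_atTop_nhds_zero_nat (𝕜 := ℝ))
  rw [mul_zero] at h
  refine h.congr fun k => ?_
  have : (k : ℝ) + 1 ≠ 0 := by positivity
  field_simp

theorem fracSpan_decaysLike {J : Set ℕ} {S : ℕ} {f : ℕ → ℝ} (hf : f ∈ fracSpan J S) :
    DecaysLike 1 f := by
  obtain ⟨L, hL⟩ := fracSpan_tendsto hf
  obtain ⟨C, hC⟩ := hL.abs.bddAbove_range
  refine ⟨C, fun k => ?_⟩
  have h : |((k : ℝ) + 1) * f k| ≤ C := hC ⟨k, rfl⟩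
  have hk : (0 : ℝ) < (k : ℝ) + 1 := by positivity
  rw [abs_mul, abs_of_pos hk] at h
  rw [pow_one, ← div_eq_mul_inv, le_div_iff₀ hk]
  linarith

theorem simpleFrac_mul_mem {j l : ℕ} (h : j ≠ l) {S : ℕ} (s t : ℕ) (h1 : 1 ≤ s + t) (hs : s ≤ S)
    (ht : t ≤ S) : simpleFrac j s * simpleFrac l t ∈ fracSpan Set.univ S := by
  induction s generalizing t with
  | zero =>
    convert simpleFrac_mem (Set.mem_univ l) (by omega : 1 ≤ t) ht using 1
    ext k
    simp [simpleFrac]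
  | succ s ihs =>
    induction t with
    | zero =>
      convert simpleFrac_mem (Set.mem_univ j) (by omega : 1 ≤ s + 1) hs using 1
      ext k
      simp [simpleFrac]
    | succ t iht =>
      have e : simpleFrac j (s + 1) * simpleFrac l (t + 1) =
          (((l : ℚ) - j)⁻¹) • (simpleFrac j (s + 1) * simpleFrac l t
            - simpleFrac j s * simpleFrac l (t + 1)) := by
        ext k
        have h3 : (l : ℝ) - j ≠ 0 := sub_ne_zero.mpr (by exact_mod_cast h.symm)
        have h4 : (k : ℝ) + 1 + j ≠ 0 := by positivity
        have h5 : (k : ℝ) + 1 + l ≠ 0 := by positivity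
        simp only [simpleFrac, Pi.mul_apply, Pi.smul_apply, Pi.sub_apply, Rat.smul_def]
        push_cast
        field_simp
        ring
      rw [e]
      exact Submodule.smul_mem _ _ (Submodule.sub_mem _ (iht (by omega) (by omega))
        (ihs (t + 1) (by omega) (by omega) ht))

theorem fracSpan_mul_mem {J J' : Set ℕ} {A S : ℕ} (h : (Disjoint J J' ∧ A ≤ S) ∨ 2 * A ≤ S)
    {f g : ℕ → ℝ} (hf : f ∈ fracSpan J A) (hg : g ∈ fracSpan J' A) :
    f * g ∈ fracSpan Set.univ S := by
  induction hf using fracSpan_induction with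
  | mem j hj s h1 h2 =>
    induction hg using fracSpan_induction with
    | mem l hl t h3 h4 =>
      by_cases hjl : j = l
      · subst hjl
        have hS : 2 * A ≤ S := h.resolve_left fun h' => Set.disjoint_left.mp h'.1 hj hl
        convert simpleFrac_mem (Set.mem_univ j) (by omega : 1 ≤ s + t) (by omega : s + t ≤ S)
          using 1
        ext k
        simp [simpleFrac, pow_add, mul_comm]
      · exact simpleFrac_mul_mem hjl s t (by omega) (by omega) (by omega)
    | zero => simp
    | add f g _ _ hf hg => rw [mul_add]; exact Submodule.add_mem _ hf hg
    | smul q f _ hf => rw [mul_smul_comm]; exact Submodule.smul_mem _ q hf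
  | zero => simp
  | add f g _ _ hf hg => rw [add_mul]; exact Submodule.add_mem _ hf hg
  | smul q f _ hf => rw [smul_mul_assoc]; exact Submodule.smul_mem _ q hf

theorem DecaysLike.mul {m m' : ℕ} {f g : ℕ → ℝ} (hf : DecaysLike m f) (hg : DecaysLike m' g) :
    DecaysLike (m + m') (f * g) := by
  obtain ⟨C, hC⟩ := hf
  obtain ⟨D, hD⟩ := hg
  refine ⟨C * D, fun k => ?_⟩
  rw [Pi.mul_apply, abs_mul, pow_add, mul_inv, mul_mul_mul_comm]
  exact mul_le_mul (hC k) (hD k) (abs_nonneg _) ((abs_nonneg _).trans (hC k))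

theorem summable_inv_pow {s : ℕ} (hs : 2 ≤ s) : Summable fun k : ℕ => (((k : ℝ) + 1) ^ s)⁻¹ := by
  have h := (summable_nat_add_iff 1).mpr (Real.summable_nat_pow_inv.mpr (by omega : 1 < s))
  simpa using h

theorem DecaysLike.summable {f : ℕ → ℝ} (hf : DecaysLike 2 f) : Summable f := by
  obtain ⟨C, hC⟩ := hf
  exact Summable.of_norm_bounded ((summable_inv_pow le_rfl).mul_left C) hC

theorem summable_zetaTail {s : ℕ} (hs : 2 ≤ s) (N : ℕ) :
    Summable fun a : ℕ => (((a : ℝ) + N + 1) ^ s)⁻¹ := by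
  simpa using (summable_nat_add_iff N).mpr (summable_inv_pow hs)

theorem zetaTail_zero (s : ℕ) : zetaTail s 0 = zv s := by
  rw [zv, tsum_pnat_eq_tsum_succ (f := fun k : ℕ => ((k : ℝ) ^ s)⁻¹)]
  simp [zetaTail]

theorem zetaTail_eq_add {s : ℕ} (hs : 2 ≤ s) (N : ℕ) :
    zetaTail s N = (((N : ℝ) + 1) ^ s)⁻¹ + zetaTail s (N + 1) := by
  rw [zetaTail, (summable_zetaTail hs N).tsum_eq_zero_add, zetaTail]
  push_cast
  simp only [zero_add]
  congr 1
  exact tsum_congr fun a => by ring_nf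

theorem zetaTail_nonneg (s N : ℕ) : 0 ≤ zetaTail s N := tsum_nonneg fun a => by positivity

theorem zetaTail_antitone {s : ℕ} (hs : 2 ≤ s) : Antitone (zetaTail s) :=
  antitone_nat_of_succ_le fun N => by
    rw [zetaTail_eq_add hs N]
    have : (0 : ℝ) ≤ (((N : ℝ) + 1) ^ s)⁻¹ := by positivity
    linarith

theorem rat_mem_zetaSpan (S : ℕ) (q : ℚ) : (q : ℝ) ∈ zetaSpan S := by
  have h : (1 : ℝ) ∈ zetaSpan S := Submodule.subset_span (Or.inl rfl)
  simpa [Rat.smul_def] using Submodule.smul_mem _ q h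

theorem rat_mul_mem_zetaSpan {S : ℕ} (q : ℚ) {x : ℝ} (hx : x ∈ zetaSpan S) :
    (q : ℝ) * x ∈ zetaSpan S := by
  simpa [Rat.smul_def] using Submodule.smul_mem _ q hx

theorem zv_mem_zetaSpan {S s : ℕ} (h2 : 2 ≤ s) (hs : s ≤ S) : zv s ∈ zetaSpan S :=
  Submodule.subset_span (Or.inr ⟨s, h2, hs, rfl⟩)

theorem zetaTail_mem_zetaSpan {S s : ℕ} (h2 : 2 ≤ s) (hs : s ≤ S) (N : ℕ) :
    zetaTail s N ∈ zetaSpan S := by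
  induction N with
  | zero => rw [zetaTail_zero]; exact zv_mem_zetaSpan h2 hs
  | succ N ih =>
    have e : zetaTail s (N + 1) = zetaTail s N - (((((N : ℚ) + 1) ^ s)⁻¹ : ℚ) : ℝ) := by
      rw [zetaTail_eq_add h2 N]
      push_cast
      ring
    rw [e]
    exact Submodule.sub_mem _ ih (rat_mem_zetaSpan _ _)

theorem exists_eq_of_mem_zetaSpan {S : ℕ} {x : ℝ} (hx : x ∈ zetaSpan S) :
    ∃ (c₀ : ℚ) (c : ℕ → ℚ), x = c₀ + ∑ s ∈ Finset.Icc 2 S, (c s : ℝ) * zv s := by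
  induction hx using Submodule.span_induction with
  | mem x hx =>
    rcases hx with rfl | ⟨s, h2, hs, rfl⟩
    · exact ⟨1, 0, by simp⟩
    · refine ⟨0, Pi.single s 1, ?_⟩
      rw [Finset.sum_eq_single s]
      · simp
      · intro t _ hts
        simp [hts]
      · intro h
        exact absurd (Finset.mem_Icc.mpr ⟨h2, hs⟩) h
  | zero => exact ⟨0, 0, by simp⟩
  | add x y _ _ hx hy =>
    obtain ⟨a, c, rfl⟩ := hx
    obtain ⟨b, d, rfl⟩ := hy
    refine ⟨a + b, c + d, ?_⟩
    simp only [Pi.add_apply, Rat.cast_add, add_mul, Finset.sum_add_distrib]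
    ring
  | smul q x _ hx =>
    obtain ⟨a, c, rfl⟩ := hx
    refine ⟨q * a, fun s => q * c s, ?_⟩
    simp only [Rat.smul_def, Rat.cast_mul, mul_add, Finset.mul_sum, mul_assoc]

/-- `f` is a principal part `∑ P s / (k+1)^s`, with orders `s` in `I`, plus the difference
`Φ k - Φ (k+1)` of some `Φ` in `fracSpan J A`. -/
def HasPrincipalPart (J : Set ℕ) (A : ℕ) (I : Finset ℕ) (f : ℕ → ℝ) (P : ℕ → ℚ) : Prop :=
  ∃ Φ ∈ fracSpan J A, ∀ k : ℕ,
    f k = ∑ s ∈ I, (P s : ℝ) * (((k : ℝ) + 1) ^ s)⁻¹ + (Φ k - Φ (k + 1))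

namespace HasPrincipalPart

variable {J : Set ℕ} {A : ℕ} {I : Finset ℕ} {f g : ℕ → ℝ} {P Q : ℕ → ℚ}

theorem zero : HasPrincipalPart J A I 0 0 := ⟨0, Submodule.zero_mem _, fun k => by simp⟩

theorem add (hf : HasPrincipalPart J A I f P) (hg : HasPrincipalPart J A I g Q) :
    HasPrincipalPart J A I (f + g) (P + Q) := by
  obtain ⟨Φ, hΦ, h⟩ := hf
  obtain ⟨Ψ, hΨ, h'⟩ := hg
  refine ⟨Φ + Ψ, Submodule.add_mem _ hΦ hΨ, fun k => ?_⟩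
  simp only [Pi.add_apply, h, h', Rat.cast_add, add_mul, Finset.sum_add_distrib]
  ring

theorem smul (q : ℚ) (hf : HasPrincipalPart J A I f P) :
    HasPrincipalPart J A I (q • f) (q • P) := by
  obtain ⟨Φ, hΦ, h⟩ := hf
  refine ⟨q • Φ, Submodule.smul_mem _ _ hΦ, fun k => ?_⟩
  simp only [Pi.smul_apply, h, Rat.smul_def, Rat.cast_mul, mul_assoc, smul_eq_mul,
    ← Finset.mul_sum]
  ring

theorem simpleFrac {j s : ℕ} (hj : ∀ m < j, m ∈ J) (h1 : 1 ≤ s) (h2 : s ≤ A) :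
    HasPrincipalPart J A (Finset.Icc 1 A) (simpleFrac j s) (Pi.single s 1) := by
  induction j with
  | zero =>
    refine ⟨0, Submodule.zero_mem _, fun k => ?_⟩
    rw [Finset.sum_eq_single s]
    · simp [_root_.simpleFrac]
    · intro t _ hts
      simp [hts]
    · intro h
      exact absurd (Finset.mem_Icc.mpr ⟨h1, h2⟩) h
  | succ j ih =>
    obtain ⟨Φ, hΦ, h⟩ := ih fun m hm => hj m (by omega)
    refine ⟨Φ - _root_.simpleFrac j s,
      Submodule.sub_mem _ hΦ (simpleFrac_mem (hj j (by omega)) h1 h2), fun k => ?_⟩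
    have e : _root_.simpleFrac (j + 1) s k = _root_.simpleFrac j s (k + 1) := by
      simp only [_root_.simpleFrac]
      push_cast
      ring_nf
    have hk := h k
    simp only [Pi.sub_apply]
    linarith

theorem residue_eq_zero (h : HasPrincipalPart J A (Finset.Icc 1 A) f P) (hA : 1 ≤ A)
    (hf : DecaysLike 2 f) : P 1 = 0 := by
  obtain ⟨Φ, hΦ, h⟩ := h
  have hinv : Tendsto (fun k : ℕ => ((k : ℝ) + 1)⁻¹) atTop (𝓝 0) := by
    simpa using tendsto_one_div_add_atTop_nhds_zero_nat (𝕜 := ℝ)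
  have hf0 : Tendsto (fun k : ℕ => ((k : ℝ) + 1) * f k) atTop (𝓝 0) := by
    obtain ⟨C, hC⟩ := hf
    refine squeeze_zero_norm (a := fun k : ℕ => C * ((k : ℝ) + 1)⁻¹) (fun k => ?_) ?_
    · have hk : (0 : ℝ) < (k : ℝ) + 1 := by positivity
      rw [Real.norm_eq_abs, abs_mul, abs_of_pos hk]
      calc ((k : ℝ) + 1) * |f k| ≤ ((k : ℝ) + 1) * (C * (((k : ℝ) + 1) ^ 2)⁻¹) :=
            mul_le_mul_of_nonneg_left (hC k) hk.le
        _ = C * ((k : ℝ) + 1)⁻¹ := by field_simp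
    · simpa using hinv.const_mul C
  have hΦ0 : Tendsto (fun k : ℕ => ((k : ℝ) + 1) * (Φ k - Φ (k + 1))) atTop (𝓝 0) := by
    obtain ⟨L, hL⟩ := fracSpan_tendsto hΦ
    have hL' := hL.comp (tendsto_add_atTop_nat 1)
    have h0 := (fracSpan_tendsto_zero hΦ).comp (tendsto_add_atTop_nat 1)
    have := (hL.sub hL').add h0
    simp only [sub_self, add_zero] at this
    refine this.congr fun k => ?_
    simp only [Function.comp]
    push_cast
    ring
  have hsum : Tendsto (fun k : ℕ => ((k : ℝ) + 1) *
      ∑ s ∈ Finset.Icc 1 A, (P s : ℝ) * (((k : ℝ) + 1) ^ s)⁻¹) atTop (𝓝 (P 1)) := by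
    have : ∀ s ∈ Finset.Icc 1 A, Tendsto (fun k : ℕ => (P s : ℝ) * (((k : ℝ) + 1)⁻¹) ^ (s - 1))
        atTop (𝓝 (if s = 1 then (P 1 : ℝ) else 0)) := by
      intro s hs
      rw [Finset.mem_Icc] at hs
      split_ifs with h1
      · subst h1
        simp
      · have := (hinv.pow (s - 1)).const_mul (P s : ℝ)
        rwa [zero_pow (by omega), mul_zero] at this
    have := tendsto_finsetSum _ this
    rw [Finset.sum_ite_eq' (Finset.Icc 1 A) 1, if_pos (Finset.mem_Icc.mpr ⟨le_rfl, hA⟩)] at this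
    refine this.congr fun k => ?_
    rw [Finset.mul_sum]
    refine Finset.sum_congr rfl fun s hs => ?_
    obtain ⟨s, rfl⟩ := Nat.exists_eq_add_of_le' (Finset.mem_Icc.mp hs).1
    have hk : (k : ℝ) + 1 ≠ 0 := by positivity
    rw [Nat.add_sub_cancel, pow_succ, inv_pow]
    field_simp
  have hall := hsum.add hΦ0
  rw [add_zero] at hall
  have := tendsto_nhds_unique (hall.congr fun k => by rw [h k]; ring) hf0
  exact_mod_cast this

theorem drop_residue (h : HasPrincipalPart J A (Finset.Icc 1 A) f P) (hA : 1 ≤ A)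
    (hf : DecaysLike 2 f) : HasPrincipalPart J A (Finset.Icc 2 A) f P := by
  have h1 := h.residue_eq_zero hA hf
  obtain ⟨Φ, hΦ, h⟩ := h
  refine ⟨Φ, hΦ, fun k => ?_⟩
  rw [h k, ← Finset.insert_Icc_succ_left_eq_Icc hA, Finset.sum_insert (by simp)]
  simp [h1]

end HasPrincipalPart

theorem exists_hasPrincipalPart {J K : Set ℕ} {A : ℕ} (hJ : ∀ j ∈ K, ∀ m < j, m ∈ J)
    {f : ℕ → ℝ} (hf : f ∈ fracSpan K A) :
    ∃ P, HasPrincipalPart J A (Finset.Icc 1 A) f P := by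
  induction hf using fracSpan_induction with
  | mem j hj s h1 h2 => exact ⟨_, HasPrincipalPart.simpleFrac (hJ j hj) h1 h2⟩
  | zero => exact ⟨_, HasPrincipalPart.zero⟩
  | add f g _ _ hf hg => exact ⟨_, hf.choose_spec.add hg.choose_spec⟩
  | smul q f _ hf => exact ⟨_, hf.choose_spec.smul q⟩

theorem tsum_telescope {u : ℕ → ℝ} (h0 : Tendsto u atTop (𝓝 0))
    (hs : Summable fun k => u k - u (k + 1)) : ∑' k, (u k - u (k + 1)) = u 0 := by
  refine tendsto_nhds_unique hs.hasSum.tendsto_sum_nat ?_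
  simp only [Finset.sum_range_sub']
  simpa using h0.const_sub (u 0)

theorem tsum_shift_eq {J : Set ℕ} {A : ℕ} {f Φ : ℕ → ℝ} {P : ℕ → ℚ} (hΦ : Φ ∈ fracSpan J A)
    (h : ∀ k : ℕ, f k =
      ∑ s ∈ Finset.Icc 2 A, (P s : ℝ) * (((k : ℝ) + 1) ^ s)⁻¹ + (Φ k - Φ (k + 1)))
    (hf : Summable f) (N : ℕ) :
    ∑' a, f (a + N) = ∑ s ∈ Finset.Icc 2 A, (P s : ℝ) * zetaTail s N + Φ N := by
  have hsum : ∀ s ∈ Finset.Icc 2 A,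
      HasSum (fun a : ℕ => (P s : ℝ) * (((a : ℝ) + N + 1) ^ s)⁻¹) ((P s : ℝ) * zetaTail s N) :=
    fun s hs => (summable_zetaTail (Finset.mem_Icc.mp hs).1 N).hasSum.mul_left _
  have hmain := hasSum_sum hsum
  have hfN : Summable fun a => f (a + N) := (summable_nat_add_iff N).mpr hf
  have hdiff : ∀ a, f (a + N) - ∑ s ∈ Finset.Icc 2 A, (P s : ℝ) * (((a : ℝ) + N + 1) ^ s)⁻¹ =
      Φ (a + N) - Φ (a + 1 + N) := by
    intro a
    rw [h (a + N), add_right_comm a N 1]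
    push_cast
    ring
  have hd := hfN.sub hmain.summable
  simp only [hdiff] at hd
  have ht := tsum_telescope (u := fun a => Φ (a + N))
    ((tendsto_add_atTop_iff_nat N).mpr (fracSpan_tendsto_zero hΦ)) hd
  rw [← hmain.tsum_eq, ← zero_add N, ← ht, zero_add, ← hmain.summable.tsum_add hd]
  refine tsum_congr fun a => ?_
  rw [← hdiff a]
  ring

theorem tsum_mem_zetaSpan {S : ℕ} (hS : 1 ≤ S) {f : ℕ → ℝ} (hf : f ∈ fracSpan Set.univ S)
    (hb : DecaysLike 2 f) : ∑' k, f k ∈ zetaSpan S := by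
  obtain ⟨P, hP⟩ := exists_hasPrincipalPart (J := Set.univ) (fun _ _ _ _ => Set.mem_univ _) hf
  obtain ⟨Φ, hΦ, h⟩ := hP.drop_residue hS hb
  have := tsum_shift_eq hΦ h hb.summable 0
  simp only [add_zero] at this
  rw [this]
  refine Submodule.add_mem _ (Submodule.sum_mem _ fun s hs => ?_) ?_
  · rw [Finset.mem_Icc] at hs
    exact rat_mul_mem_zetaSpan _ (zetaTail_mem_zetaSpan hs.1 hs.2 0)
  · obtain ⟨q, hq⟩ := fracSpan_apply_rat hΦ 0
    rw [hq]
    exact rat_mem_zetaSpan _ _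

theorem tsum_mul_mem_zetaSpan {J J' : Set ℕ} {A S : ℕ} (hA : 1 ≤ A)
    (h : (Disjoint J J' ∧ A ≤ S) ∨ 2 * A ≤ S)
    {f g : ℕ → ℝ} (hf : f ∈ fracSpan J A) (hg : g ∈ fracSpan J' A) :
    ∑' k, f k * g k ∈ zetaSpan S :=
  tsum_mem_zetaSpan (f := f * g) (by omega) (fracSpan_mul_mem h hf hg)
    ((fracSpan_decaysLike hf).mul (fracSpan_decaysLike hg))

/-- The pairs `(k₁, k₂)` with `k₁ ≥ k₂ + c` and `k₂ ≥ 1`, parametrised by `k₂ - 1` and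
`k₁ - k₂ - c`. -/
def offsetEquiv (c : ℕ) : ℕ × ℕ ≃ {q : ℕ × ℕ // q.2 + c ≤ q.1 ∧ 1 ≤ q.2} where
  toFun p := ⟨(p.2 + p.1 + 1 + c, p.1 + 1), by dsimp only; omega⟩
  invFun q := (q.1.2 - 1, q.1.1 - q.1.2 - c)
  left_inv p := by ext <;> simp; omega
  right_inv q := by
    obtain ⟨⟨a, b⟩, h1, h2⟩ := q
    simp only at h1 h2
    ext <;> simp <;> omega

theorem DecaysLike.abs_shift_le {f : ℕ → ℝ} {C : ℝ}
    (hC : ∀ k : ℕ, |f k| ≤ C * (((k : ℝ) + 1) ^ 2)⁻¹) (a N : ℕ) :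
    |f (a + N)| ≤ C * (((a : ℝ) + 1) ^ 2)⁻¹ := by
  have hC0 : 0 ≤ C := by simpa using (abs_nonneg _).trans (hC 0)
  refine (hC _).trans (mul_le_mul_of_nonneg_left ?_ hC0)
  gcongr
  simp

theorem DecaysLike.summable_double {f g : ℕ → ℝ} (hf : DecaysLike 2 f) (hg : DecaysLike 2 g)
    (r : ℕ) : Summable fun p : ℕ × ℕ => f (p.2 + p.1 + r) * g p.1 := by
  obtain ⟨C, hC⟩ := hf
  obtain ⟨D, hD⟩ := hg
  have h2 := summable_inv_pow (le_refl 2)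
  have hs := (h2.mul_of_nonneg h2 (fun k => by positivity) (fun k => by positivity)).mul_left
    (C * D)
  refine Summable.of_norm_bounded hs fun p => ?_
  rw [Real.norm_eq_abs, abs_mul, add_assoc]
  have h1 := DecaysLike.abs_shift_le hC p.2 (p.1 + r)
  calc _ ≤ (C * (((p.2 : ℝ) + 1) ^ 2)⁻¹) * (D * (((p.1 : ℝ) + 1) ^ 2)⁻¹) :=
        mul_le_mul h1 (hD _) (abs_nonneg _) ((abs_nonneg _).trans h1)
    _ = _ := by ring

theorem decaysLike_simpleFrac_zero {t : ℕ} (ht : 2 ≤ t) : DecaysLike 2 (simpleFrac 0 t) := by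
  refine ⟨1, fun k => ?_⟩
  rw [one_mul, simpleFrac, Nat.cast_zero, add_zero, abs_of_nonneg (by positivity)]
  gcongr
  simp

theorem tsum_double_eq {f g : ℕ → ℝ} (hf : DecaysLike 2 f) (hg : DecaysLike 2 g) (r : ℕ) :
    ∑' p : ℕ × ℕ, f (p.2 + p.1 + r) * g p.1 = ∑' b, g b * ∑' a, f (a + (b + r)) := by
  rw [(hf.summable_double hg r).tsum_prod]
  refine tsum_congr fun b => ?_
  rw [← tsum_mul_left]
  exact tsum_congr fun a => by rw [add_assoc, mul_comm]

theorem dzv_eq {s t : ℕ} (hs : 2 ≤ s) (ht : 2 ≤ t) :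
    dzv s t = ∑' b, simpleFrac 0 t b * zetaTail s (b + 1) := by
  let e : ℕ × ℕ ≃ {q : ℕ × ℕ // q.2 < q.1 ∧ 1 ≤ q.2} := offsetEquiv 1
  rw [dzv, ← e.tsum_eq]
  have h := tsum_double_eq (decaysLike_simpleFrac_zero hs) (decaysLike_simpleFrac_zero ht) 1
  have h' : ∀ b, ∑' a, simpleFrac 0 s (a + (b + 1)) = zetaTail s (b + 1) := fun b =>
    tsum_congr fun a => by simp [simpleFrac]
  simp only [h'] at h
  rw [← h]
  refine tsum_congr fun p => ?_
  simp only [e, offsetEquiv, Equiv.coe_fn_mk, simpleFrac, mul_inv]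
  push_cast
  ring_nf

theorem DecaysLike.mul_zetaTail {m : ℕ} {g : ℕ → ℝ} (hg : DecaysLike m g) {s : ℕ} (hs : 2 ≤ s)
    (r : ℕ) : DecaysLike m fun b => g b * zetaTail s (b + r) := by
  obtain ⟨C, hC⟩ := hg
  refine ⟨C * zetaTail s 0, fun k => ?_⟩
  rw [abs_mul, abs_of_nonneg (zetaTail_nonneg _ _), mul_right_comm]
  exact mul_le_mul (hC k) (zetaTail_antitone hs (Nat.zero_le _)) (zetaTail_nonneg _ _)
    ((abs_nonneg _).trans (hC k))

theorem tsum_simpleFrac_mul_zetaTail {S s t r : ℕ} (hs : 2 ≤ s) (ht : 2 ≤ t) (hsS : s ≤ S)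
    (htS : t ≤ S) (h : r = 0 → s + t ≤ S) :
    ∑' b, simpleFrac 0 t b * zetaTail s (b + r) - dzv s t ∈ zetaSpan S := by
  have hd := decaysLike_simpleFrac_zero ht
  have step : ∀ r, ∑' b, simpleFrac 0 t b * zetaTail s (b + r) =
      ∑' b, simpleFrac 0 t b * simpleFrac r s b +
        ∑' b, simpleFrac 0 t b * zetaTail s (b + (r + 1)) := by
    intro r
    have h1 : Summable fun b => simpleFrac 0 t b * simpleFrac r s b := by
      have := (hd.mul (fracSpan_decaysLike (simpleFrac_mem (Set.mem_univ r) (by omega : 1 ≤ s)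
        le_rfl)))
      obtain ⟨C, hC⟩ := this
      exact Summable.of_norm_bounded ((summable_inv_pow (by omega)).mul_left C) hC
    rw [← h1.tsum_add (hd.mul_zetaTail hs (r + 1)).summable]
    refine tsum_congr fun b => ?_
    rw [← mul_add, zetaTail_eq_add hs (b + r), simpleFrac, simpleFrac]
    push_cast
    ring_nf
  have pos : ∀ r, ∑' b, simpleFrac 0 t b * zetaTail s (b + (r + 1)) - dzv s t ∈ zetaSpan S := by
    intro r
    induction r with
    | zero => simp [dzv_eq hs ht]
    | succ r ih =>
      rw [step (r + 1), add_comm (∑' _, _) (∑' _, _)] at ih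
      have hm : ∑' b, simpleFrac 0 t b * simpleFrac (r + 1) s b ∈ zetaSpan S :=
        tsum_mul_mem_zetaSpan (J := {0}) (J' := {r + 1}) (A := S) (by omega)
          (Or.inl ⟨by simp, le_rfl⟩) (simpleFrac_mem (by simp) (by omega) htS)
          (simpleFrac_mem (by simp) (by omega) hsS)
      convert Submodule.sub_mem _ ih hm using 1
      ring
  rcases r with _ | r
  · rw [step 0, add_sub_assoc]
    refine Submodule.add_mem _ ?_ (pos 0)
    have : ∀ b, simpleFrac 0 t b * simpleFrac 0 s b = simpleFrac 0 (s + t) b := fun b => by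
      simp [simpleFrac, pow_add]
    simp only [this]
    exact tsum_mem_zetaSpan (by have := h rfl; omega)
      (simpleFrac_mem (Set.mem_univ _) (by omega) (h rfl))
      (decaysLike_simpleFrac_zero (by omega))
  · exact pos r

theorem tsum_mul_zetaTail {n A S r s : ℕ} (hA : 1 ≤ A) (hs : 2 ≤ s) (hsA : s ≤ A)
    (hS : (n + 1 ≤ r ∧ A ≤ S) ∨ 2 * A ≤ S) {g Ψ : ℕ → ℝ} {Q : ℕ → ℚ}
    (hΨ : Ψ ∈ fracSpan (Set.Iio n) A) (hg : DecaysLike 2 g)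
    (h : ∀ k : ℕ, g k =
      ∑ t ∈ Finset.Icc 2 A, (Q t : ℝ) * (((k : ℝ) + 1) ^ t)⁻¹ + (Ψ k - Ψ (k + 1))) :
    ∑' b, g b * zetaTail s (b + r) - ∑ t ∈ Finset.Icc 2 A, (Q t : ℝ) * dzv s t ∈ zetaSpan S := by
  have hmain : ∀ t ∈ Finset.Icc 2 A, Summable fun b : ℕ =>
      (Q t : ℝ) * (simpleFrac 0 t b * zetaTail s (b + r)) := fun t ht =>
    ((decaysLike_simpleFrac_zero (Finset.mem_Icc.mp ht).1).mul_zetaTail hs r).summable.mul_left _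
  have hΨ1 := fracSpan_shift (r := 1) (J' := Set.Icc 1 n)
    (fun j (hj : j < n) => ⟨by omega, by omega⟩) hΨ
  have hrs : simpleFrac r s ∈ fracSpan {r} A := simpleFrac_mem rfl (by omega) hsA
  have hprod : Summable fun b => Ψ (b + 1) * simpleFrac r s b :=
    ((fracSpan_decaysLike hΨ1).mul (fracSpan_decaysLike hrs)).summable
  have hZ : ∀ b, zetaTail s (b + r) = simpleFrac r s b + zetaTail s (b + 1 + r) := fun b => by
    rw [zetaTail_eq_add hs (b + r), simpleFrac, add_right_comm b 1 r]
    push_cast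
    ring_nf
  have hsplit : ∀ b, g b * zetaTail s (b + r) =
      ∑ t ∈ Finset.Icc 2 A, (Q t : ℝ) * (simpleFrac 0 t b * zetaTail s (b + r))
        - Ψ (b + 1) * simpleFrac r s b
        + (Ψ b * zetaTail s (b + r) - Ψ (b + 1) * zetaTail s (b + 1 + r)) := by
    intro b
    have e : ∑ t ∈ Finset.Icc 2 A, (Q t : ℝ) * (simpleFrac 0 t b * zetaTail s (b + r)) =
        (∑ t ∈ Finset.Icc 2 A, (Q t : ℝ) * (((b : ℝ) + 1) ^ t)⁻¹) * zetaTail s (b + r) := by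
      rw [Finset.sum_mul]
      refine Finset.sum_congr rfl fun t _ => ?_
      simp [simpleFrac, mul_assoc]
    rw [e, h b, hZ b]
    ring
  have hfirst := summable_sum hmain
  have htel : Summable fun b =>
      Ψ b * zetaTail s (b + r) - Ψ (b + 1) * zetaTail s (b + 1 + r) := by
    refine ((hg.mul_zetaTail hs r).summable.sub (hfirst.sub hprod)).congr fun b => ?_
    rw [hsplit b]
    ring
  have hlim : Tendsto (fun b => Ψ b * zetaTail s (b + r)) atTop (𝓝 0) := by
    obtain ⟨C, hC⟩ := (fracSpan_decaysLike hΨ).mul_zetaTail hs r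
    refine squeeze_zero_norm hC ?_
    simpa using (tendsto_one_div_add_atTop_nhds_zero_nat (𝕜 := ℝ)).const_mul C
  have hval : ∑' b, g b * zetaTail s (b + r) =
      ∑ t ∈ Finset.Icc 2 A, (Q t : ℝ) * ∑' b, simpleFrac 0 t b * zetaTail s (b + r)
        - ∑' b, Ψ (b + 1) * simpleFrac r s b + Ψ 0 * zetaTail s r := by
    rw [tsum_congr hsplit, (hfirst.sub hprod).tsum_add htel, hfirst.tsum_sub hprod,
      Summable.tsum_finsetSum hmain, tsum_telescope hlim htel, zero_add]
    simp only [tsum_mul_left]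
  obtain ⟨q, hq⟩ := fracSpan_apply_rat hΨ 0
  have hAS : A ≤ S := by omega
  rw [hval, hq, add_sub_right_comm, sub_right_comm, ← Finset.sum_sub_distrib]
  refine Submodule.add_mem _ (Submodule.sub_mem _ (Submodule.sum_mem _ fun t ht => ?_) ?_)
    (rat_mul_mem_zetaSpan _ (zetaTail_mem_zetaSpan hs (hsA.trans hAS) _))
  · rw [Finset.mem_Icc] at ht
    rw [← mul_sub]
    exact rat_mul_mem_zetaSpan _ (tsum_simpleFrac_mul_zetaTail hs ht.1 (by omega) (by omega)
      (by omega))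
  · refine tsum_mul_mem_zetaSpan hA (hS.imp_left fun h => ⟨?_, h.2⟩) hΨ1 hrs
    rw [Set.disjoint_singleton_right, Set.mem_Icc]
    omega

theorem tsum_double_mem {n A S r : ℕ} (hA : 1 ≤ A) (hS : (n + 1 ≤ r ∧ A ≤ S) ∨ 2 * A ≤ S)
    {f g : ℕ → ℝ} {P Q : ℕ → ℚ} (hf : DecaysLike 2 f) (hg : DecaysLike 2 g)
    (hgW : g ∈ fracSpan (Set.Iio (n + 1)) A)
    (hP : HasPrincipalPart (Set.Iio n) A (Finset.Icc 2 A) f P)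
    (hQ : HasPrincipalPart (Set.Iio n) A (Finset.Icc 2 A) g Q) :
    ∑' p : ℕ × ℕ, f (p.2 + p.1 + r) * g p.1 -
      ∑ s ∈ Finset.Icc 2 A, ∑ t ∈ Finset.Icc 2 A, ((P s * Q t : ℚ) : ℝ) * dzv s t
        ∈ zetaSpan S := by
  obtain ⟨Φ, hΦ, hf'⟩ := hP
  obtain ⟨Ψ, hΨ, hg'⟩ := hQ
  have hΦr := fracSpan_shift (r := r) (J' := Set.Ico r (n + r))
    (fun j (hj : j < n) => ⟨by omega, by omega⟩) hΦ
  have hmain : ∀ s ∈ Finset.Icc 2 A, Summable fun b : ℕ =>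
      (P s : ℝ) * (g b * zetaTail s (b + r)) := fun s hs =>
    (hg.mul_zetaTail (Finset.mem_Icc.mp hs).1 r).summable.mul_left _
  have hprod : Summable fun b => g b * Φ (b + r) :=
    ((fracSpan_decaysLike hgW).mul (fracSpan_decaysLike hΦr)).summable
  have hval : ∑' p : ℕ × ℕ, f (p.2 + p.1 + r) * g p.1 =
      ∑ s ∈ Finset.Icc 2 A, (P s : ℝ) * ∑' b, g b * zetaTail s (b + r)
        + ∑' b, g b * Φ (b + r) := by
    rw [tsum_double_eq hf hg]
    simp only [tsum_shift_eq hΦ hf' hf.summable, ← tsum_mul_left]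
    rw [← Summable.tsum_finsetSum hmain, ← (summable_sum hmain).tsum_add hprod]
    refine tsum_congr fun b => ?_
    rw [mul_add, Finset.mul_sum]
    congr 1
    exact Finset.sum_congr rfl fun s _ => by ring
  rw [hval, add_sub_right_comm, ← Finset.sum_sub_distrib]
  refine Submodule.add_mem _ (Submodule.sum_mem _ fun s hs => ?_) ?_
  · rw [Finset.mem_Icc] at hs
    have e : ∑ t ∈ Finset.Icc 2 A, ((P s * Q t : ℚ) : ℝ) * dzv s t =
        (P s : ℝ) * ∑ t ∈ Finset.Icc 2 A, (Q t : ℝ) * dzv s t := by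
      rw [Finset.mul_sum]
      exact Finset.sum_congr rfl fun t _ => by push_cast; ring
    rw [e, ← mul_sub]
    exact rat_mul_mem_zetaSpan _ (tsum_mul_zetaTail hA hs.1 hs.2 hS hΨ hg hg')
  · refine tsum_mul_mem_zetaSpan hA (hS.imp_left fun h => ⟨?_, h.2⟩) hgW hΦr
    rw [Set.disjoint_left]
    rintro j (hj : j < n + 1) hj'
    rw [Set.mem_Ico] at hj'
    omega

theorem natDegree_prod_X_sub_C_pow (T : Finset ℕ) (A : ℕ) :
    (∏ j ∈ T, (X - C (-(j : ℚ))) ^ A).natDegree = A * T.card := by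
  rw [natDegree_prod_of_monic _ _ fun j _ => (monic_X_sub_C _).pow A]
  simp only [natDegree_pow, natDegree_X_sub_C, Finset.sum_const, smul_eq_mul, mul_one, mul_comm]

theorem exists_partialFractions {n A : ℕ} (N : ℚ[X]) (hN : N.degree < (A * (n + 1) : ℕ)) :
    ∃ a : ℕ → Fin A → ℚ, ∀ x : ℝ, (∀ j ∈ Finset.range (n + 1), x + j ≠ 0) →
      aeval x N / (∏ j ∈ Finset.range (n + 1), (x + j)) ^ A =
        ∑ j ∈ Finset.range (n + 1), ∑ i : Fin A, (a j i : ℝ) * ((x + j) ^ (A - i))⁻¹ := by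
  obtain ⟨q, c, hc, hf⟩ := eq_quo_mul_prod_pow_add_sum_rem_mul_prod_pow
    (s := Finset.range (n + 1)) N (g := fun j : ℕ => X - C (-(j : ℚ)))
    (fun j _ => monic_X_sub_C _)
    ((pairwise_coprime_X_sub_C (s := fun j : ℕ => -(j : ℚ))
      fun a b h => by simpa using h).set_pairwise _) (fun _ => A)
  have hconst : ∀ j ∈ Finset.range (n + 1), ∀ i : Fin A, c j i = C ((c j i).coeff 0) := by
    intro j hj i
    have := hc j hj i
    rw [degree_X_sub_C] at this
    exact eq_C_of_degree_le_zero (Nat.WithBot.lt_one_iff_le_zero.mp this)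
  have hq : q = 0 := by
    by_contra hq
    have hmonic : (∏ j ∈ Finset.range (n + 1), (X - C (-(j : ℚ))) ^ A).Monic :=
      monic_prod_of_monic _ _ fun j _ => (monic_X_sub_C _).pow A
    have hdeg : ((A * (n + 1) : ℕ) : WithBot ℕ) ≤
        (q * ∏ j ∈ Finset.range (n + 1), (X - C (-(j : ℚ))) ^ A).degree := by
      rw [hmonic.degree_mul, degree_eq_natDegree hmonic.ne_zero, natDegree_prod_X_sub_C_pow,
        Finset.card_range, degree_eq_natDegree hq, ← Nat.cast_add]
      exact_mod_cast Nat.le_add_left _ _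
    have hlt : q * ∏ j ∈ Finset.range (n + 1), (X - C (-(j : ℚ))) ^ A
        ∈ degreeLT ℚ (A * (n + 1)) := by
      rw [eq_sub_of_add_eq hf.symm]
      refine Submodule.sub_mem _ (mem_degreeLT.mpr hN)
        (Submodule.sum_mem _ fun j hj => Submodule.sum_mem _ fun i _ => mem_degreeLT.mpr ?_)
      refine degree_le_natDegree.trans_lt (Nat.cast_lt.mpr ?_)
      rw [hconst j hj i]
      refine (natDegree_mul_le.trans (Nat.add_le_add_right natDegree_mul_le _)).trans_lt ?_
      rw [natDegree_C, natDegree_prod_X_sub_C_pow, Finset.card_erase_of_mem hj,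
        Finset.card_range, natDegree_pow, natDegree_X_sub_C, Nat.add_sub_cancel, mul_add]
      have := i.2
      omega
    exact absurd hdeg (not_le.mpr (mem_degreeLT.mp hlt))
  refine ⟨fun j i => (c j i).coeff 0, fun x hx => ?_⟩
  have hD : (∏ j ∈ Finset.range (n + 1), (x + (j : ℝ)) ^ A) ≠ 0 :=
    Finset.prod_ne_zero_iff.mpr fun j hj => pow_ne_zero _ (hx j hj)
  rw [← Finset.prod_pow, hf, hq, zero_mul, zero_add, map_sum, Finset.sum_div]
  refine Finset.sum_congr rfl fun j hj => ?_
  rw [map_sum, Finset.sum_div]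
  refine Finset.sum_congr rfl fun i _ => ?_
  rw [← Finset.mul_prod_erase _ _ hj] at hD ⊢
  have h1 := left_ne_zero_of_mul hD
  have h2 := right_ne_zero_of_mul hD
  have hA : (x + (j : ℝ)) ^ A = (x + (j : ℝ)) ^ (i : ℕ) * (x + (j : ℝ)) ^ (A - (i : ℕ)) := by
    rw [← pow_add, Nat.add_sub_cancel' i.2.le]
  have h3 : (x + (j : ℝ)) ^ (i : ℕ) ≠ 0 := pow_ne_zero _ (hx j hj)
  have h4 : (x + (j : ℝ)) ^ (A - (i : ℕ)) ≠ 0 := pow_ne_zero _ (hx j hj)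
  have hval : aeval x (c j i) = ((c j i).coeff 0 : ℝ) := by
    conv_lhs => rw [hconst j hj i]
    simp
  simp only [map_mul, map_pow, map_prod, map_add, aeval_X, map_neg, map_natCast, sub_neg_eq_add,
    hval, hA]
  field_simp

/-- The rational function `(x (x + n))^i / ((x)_{n+1})^A`. -/
noncomputable def kernelFun (n A i : ℕ) (x : ℝ) : ℝ :=
  (x * (x + n)) ^ i / (∏ j ∈ Finset.range (n + 1), (x + j)) ^ A

theorem kernelFun_reflect (n A i : ℕ) (x : ℝ) :
    kernelFun n A i (-x - n) = (-1) ^ (A * (n + 1)) * kernelFun n A i x := by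
  have h : ∏ j ∈ Finset.range (n + 1), (-x - n + j) =
      (-1) ^ (n + 1) * ∏ j ∈ Finset.range (n + 1), (x + j) := by
    rw [← Finset.prod_range_reflect (fun j : ℕ => x + (j : ℝ)), ← Finset.card_range (n + 1),
      ← Finset.prod_const, Finset.card_range, ← Finset.prod_mul_distrib]
    refine Finset.prod_congr rfl fun j hj => ?_
    rw [Finset.mem_range] at hj
    rw [Nat.add_sub_cancel, Nat.cast_sub (by omega)]
    ring
  have hsq : ((-1 : ℝ) ^ (A * (n + 1)))⁻¹ = (-1) ^ (A * (n + 1)) := by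
    rw [← inv_pow, inv_neg_one]
  have hpow (y : ℝ) : ((-1) ^ (n + 1) * y) ^ A = (-1) ^ (A * (n + 1)) * y ^ A := by
    rw [mul_pow, ← pow_mul, mul_comm (n + 1)]
  rw [kernelFun, kernelFun, h, hpow, div_eq_mul_inv, mul_inv, hsq, div_eq_mul_inv,
    show (-x - n) * (-x - n + n) = x * (x + n) by ring]
  ring

theorem decaysLike_kernelFun {n A i : ℕ} (hi : 2 * i + 2 ≤ A * (n + 1)) :
    DecaysLike 2 fun k => kernelFun n A i (k + 1) := by
  refine ⟨((n : ℝ) + 1) ^ i, fun k => ?_⟩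
  set x : ℝ := (k : ℝ) + 1 with hx
  have hx1 : 1 ≤ x := by simp [hx]
  have hx0 : 0 < x := by linarith
  have hprod : x ^ (n + 1) ≤ ∏ j ∈ Finset.range (n + 1), (x + j) := by
    rw [← Finset.card_range (n + 1), ← Finset.prod_const, Finset.card_range]
    exact Finset.prod_le_prod (fun _ _ => hx0.le) fun j _ => by simp
  have hnum : x * (x + n) ≤ (n + 1) * x ^ 2 := by
    have : (0 : ℝ) ≤ n * x * (x - 1) := by
      have : 0 ≤ x - 1 := by linarith
      positivity
    nlinarith
  have hnn : 0 ≤ kernelFun n A i x := by unfold kernelFun; positivity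
  rw [abs_of_nonneg hnn, ← div_eq_mul_inv, kernelFun]
  rw [div_le_div_iff₀ (by positivity) (by positivity)]
  calc (x * (x + n)) ^ i * x ^ 2 ≤ ((n + 1) * x ^ 2) ^ i * x ^ 2 := by gcongr
    _ = (n + 1) ^ i * x ^ (2 * i + 2) := by rw [mul_pow, ← pow_mul, mul_assoc, ← pow_add]
    _ ≤ (n + 1) ^ i * x ^ (A * (n + 1)) := by gcongr
    _ = (n + 1) ^ i * (x ^ (n + 1)) ^ A := by rw [← pow_mul, mul_comm A]
    _ ≤ _ := by gcongr

theorem degree_kernel_numerator (n i : ℕ) :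
    ((X * (X + C (n : ℚ))) ^ i).natDegree ≤ 2 * i := by
  have : (X * (X + C (n : ℚ))).natDegree ≤ 2 :=
    natDegree_mul_le.trans (by rw [natDegree_X, natDegree_X_add_C])
  calc _ ≤ i * _ := natDegree_pow_le
    _ ≤ i * 2 := by gcongr
    _ = _ := mul_comm _ _

/-- The data of a partial fraction expansion with poles at `0, …, -n` whose principal part
contains only orders of the same parity as `p`. -/
def HasParityExpansion (n A p : ℕ) (f : ℕ → ℝ) : Prop :=
  f ∈ fracSpan (Set.Iio (n + 1)) A ∧
    ∃ P, HasPrincipalPart (Set.Iio n) A (Finset.Icc 1 A) f P ∧ ∀ s, s % 2 ≠ p % 2 → P s = 0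

namespace HasParityExpansion

variable {n A p : ℕ} {f g : ℕ → ℝ}

theorem zero : HasParityExpansion n A p 0 :=
  ⟨Submodule.zero_mem _, 0, HasPrincipalPart.zero, fun _ _ => rfl⟩

theorem add (hf : HasParityExpansion n A p f) (hg : HasParityExpansion n A p g) :
    HasParityExpansion n A p (f + g) := by
  obtain ⟨hf, P, hP, hP'⟩ := hf
  obtain ⟨hg, Q, hQ, hQ'⟩ := hg
  exact ⟨Submodule.add_mem _ hf hg, P + Q, hP.add hQ, fun s hs => by simp [hP' s hs, hQ' s hs]⟩

theorem smul (q : ℚ) (hf : HasParityExpansion n A p f) : HasParityExpansion n A p (q • f) := by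
  obtain ⟨hf, P, hP, hP'⟩ := hf
  exact ⟨Submodule.smul_mem _ _ hf, q • P, hP.smul q, fun s hs => by simp [hP' s hs]⟩

theorem sum {ι : Type*} {T : Finset ι} {f : ι → ℕ → ℝ}
    (h : ∀ i ∈ T, HasParityExpansion n A p (f i)) :
    HasParityExpansion n A p (∑ i ∈ T, f i) :=
  Finset.sum_induction f _ (fun _ _ => add) zero h

theorem symmetrized {j s : ℕ} (hj : j ≤ n) (h1 : 1 ≤ s) (h2 : s ≤ A) :
    HasParityExpansion n A p (simpleFrac j s + ((-1 : ℚ) ^ (p + s)) • simpleFrac (n - j) s) := by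
  refine ⟨Submodule.add_mem _ (simpleFrac_mem (Set.mem_Iio.mpr (by omega)) h1 h2)
    (Submodule.smul_mem _ _ (simpleFrac_mem (Set.mem_Iio.mpr (by omega)) h1 h2)),
    _, (HasPrincipalPart.simpleFrac (fun m hm => Set.mem_Iio.mpr (by omega)) h1 h2).add
      ((HasPrincipalPart.simpleFrac (fun m hm => Set.mem_Iio.mpr (by omega)) h1 h2).smul _),
    fun t ht => ?_⟩
  by_cases hts : t = s
  · subst hts
    have : Odd (p + t) := by rw [Nat.odd_iff]; omega
    simp [this.neg_one_pow]
  · simp [hts]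

end HasParityExpansion

theorem kernelFun_hasParityExpansion {n A i : ℕ} (hi : 2 * i + 2 ≤ A * (n + 1)) :
    HasParityExpansion n A (A * (n + 1)) fun k => kernelFun n A i (k + 1) := by
  obtain ⟨a, ha⟩ := exists_partialFractions (n := n) (A := A) ((X * (X + C (n : ℚ))) ^ i)
    (degree_le_natDegree.trans_lt (Nat.cast_lt.mpr (by
      have := degree_kernel_numerator n i; omega)))
  have ha' : ∀ x : ℝ, (∀ j ∈ Finset.range (n + 1), x + j ≠ 0) → kernelFun n A i x =
      ∑ j ∈ Finset.range (n + 1), ∑ i : Fin A, (a j i : ℝ) * ((x + j) ^ (A - i))⁻¹ := by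
    intro x hx
    rw [← ha x hx, kernelFun]
    simp
  have e : (fun k : ℕ => kernelFun n A i (k + 1)) =
      ∑ j ∈ Finset.range (n + 1), ∑ l : Fin A, (a j l / 2) •
        (simpleFrac j (A - l) +
          ((-1 : ℚ) ^ (A * (n + 1) + (A - l))) • simpleFrac (n - j) (A - l)) := by
    ext k
    have h1 := ha' (k + 1) fun j _ => by positivity
    have h2 := ha' (-((k : ℝ) + 1) - n) fun j hj => by
      rw [Finset.mem_range_succ_iff] at hj
      have : (j : ℝ) ≤ n := by exact_mod_cast hj
      have hk : (0 : ℝ) ≤ k := by positivity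
      linarith
    rw [kernelFun_reflect] at h2
    have h3 : kernelFun n A i (k + 1) = (kernelFun n A i (k + 1) + (-1) ^ (A * (n + 1)) *
        ((-1) ^ (A * (n + 1)) * kernelFun n A i (k + 1))) / 2 := by
      rw [← mul_assoc, ← mul_pow]
      norm_num
    rw [h3, h2, h1, Finset.mul_sum, ← Finset.sum_add_distrib, Finset.sum_div, Finset.sum_apply]
    refine Finset.sum_congr rfl fun j hj => ?_
    rw [Finset.mul_sum, ← Finset.sum_add_distrib, Finset.sum_div, Finset.sum_apply]
    refine Finset.sum_congr rfl fun l _ => ?_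
    rw [Finset.mem_range_succ_iff] at hj
    have h4 : ((-((k : ℝ) + 1) - n + j) ^ (A - (l : ℕ)))⁻¹ =
        (-1) ^ (A - (l : ℕ)) * (((k : ℝ) + 1 + (n - j : ℕ)) ^ (A - (l : ℕ)))⁻¹ := by
      rw [Nat.cast_sub hj, show -((k : ℝ) + 1) - n + j = (-1) * ((k : ℝ) + 1 + (n - j)) by ring,
        mul_pow, mul_inv, ← inv_pow (-1 : ℝ), inv_neg_one]
    rw [h4]
    simp only [simpleFrac, Pi.smul_apply, Pi.add_apply, Rat.smul_def]
    push_cast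
    ring
  rw [e]
  refine HasParityExpansion.sum fun j hj => HasParityExpansion.sum fun l _ =>
    (HasParityExpansion.symmetrized ?_ ?_ ?_).smul _
  · exact Finset.mem_range_succ_iff.mp hj
  · have := l.2; omega
  · omega

theorem ascPochhammer_eval_eq_prod (n : ℕ) (x : ℝ) :
    (ascPochhammer ℝ n).eval x = ∏ j ∈ Finset.range n, (x + j) := by
  induction n with
  | zero => simp
  | succ n ih => rw [ascPochhammer_succ_eval, ih, Finset.prod_range_succ]

theorem sum_symmetric_eq {A e p : ℕ} {D : ℕ × ℕ → ℚ} (z : ℕ × ℕ → ℝ)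
    (hD : ∀ q, D q.swap = (-1) ^ e * D q)
    (hp : ∀ q, q.1 % 2 ≠ p % 2 ∨ q.2 % 2 ≠ p % 2 → D q = 0) :
    ∃ d : ℕ × ℕ → ℚ, ∑ s ∈ Finset.Icc 2 A, ∑ t ∈ Finset.Icc 2 A, (D (s, t) : ℝ) * z (s, t) =
      ∑ q ∈ (Finset.Icc 2 A ×ˢ Finset.Icc 2 A).filter
          (fun q => q.1 ≤ q.2 ∧ q.1 % 2 = p % 2 ∧ q.2 % 2 = p % 2 ∧ (q.1 = q.2 → e % 2 = 0)),
        (d q : ℝ) * (z q + (-1 : ℝ) ^ e * z q.swap) := by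
  let d : ℕ × ℕ → ℚ := fun q => if q.1 = q.2 then D q / 2 else D q
  have hd0 : ∀ q, D q = 0 → d q = 0 := fun q h => by simp [d, h]
  have hdiag : ∀ s, e % 2 ≠ 0 → D (s, s) = 0 := by
    intro s he
    have h := hD (s, s)
    rw [(Nat.odd_iff.mpr (by omega)).neg_one_pow, Prod.swap_prod_mk] at h
    linarith
  let u : ℕ × ℕ → ℝ := fun q => if q.1 ≤ q.2 then (d q : ℝ) * z q else 0
  let v : ℕ × ℕ → ℝ := fun q => if q.1 ≤ q.2 then (d q : ℝ) * ((-1) ^ e * z q.swap) else 0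
  refine ⟨d, ?_⟩
  have hterm : ∀ q, (if q.1 ≤ q.2 ∧ q.1 % 2 = p % 2 ∧ q.2 % 2 = p % 2 ∧ (q.1 = q.2 → e % 2 = 0)
      then (d q : ℝ) * (z q + (-1 : ℝ) ^ e * z q.swap) else 0) = u q + v q := by
    intro q
    by_cases h1 : q.1 ≤ q.2
    · simp only [u, v, if_pos h1]
      split_ifs with h
      · ring
      · have : D q = 0 := by
          by_cases h2 : q.1 % 2 = p % 2 ∧ q.2 % 2 = p % 2
          · obtain ⟨s, t⟩ := q
            have h3 : s = t ∧ e % 2 ≠ 0 := by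
              by_contra h3
              exact h ⟨h1, h2.1, h2.2, fun hst => by by_contra he; exact h3 ⟨hst, he⟩⟩
            obtain ⟨rfl, he⟩ := h3
            exact hdiag s he
          · exact hp q (by tauto)
        simp [hd0 q this]
    · simp [u, v, h1]
  have hswap : ∀ q, u q + v q.swap = (D q : ℝ) * z q := by
    rintro ⟨s, t⟩
    have hDst : (D (t, s) : ℝ) = (-1) ^ e * D (s, t) := by exact_mod_cast hD (s, t)
    rcases lt_trichotomy s t with h | rfl | h
    · simp [u, v, d, h.le, h.ne, not_le.mpr h]
    · simp only [u, v, d, le_refl, if_true, Prod.swap_prod_mk]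
      push_cast
      linear_combination (-z (s, s) / 2) * hDst
    · simp only [u, v, d, h.le, h.ne, not_le.mpr h, Prod.swap_prod_mk, if_true, if_false]
      have h1 : (-1 : ℝ) ^ e * (-1) ^ e = 1 := by rw [← mul_pow]; norm_num
      rw [hDst]
      linear_combination (D (s, t) * z (s, t) : ℝ) * h1
  rw [Finset.sum_filter, Finset.sum_congr rfl fun q _ => hterm q, Finset.sum_add_distrib,
    Finset.sum_product, Finset.sum_product, Finset.sum_comm (f := fun s t => v (s, t)),
    ← Finset.sum_add_distrib]
  refine Finset.sum_congr rfl fun s _ => ?_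
  rw [← Finset.sum_add_distrib]
  exact Finset.sum_congr rfl fun t _ => (hswap (s, t)).symm

theorem statement15 (A n r e : ℕ) (hA : 2 ≤ A) (he : 2 * e + 2 ≤ A * (n + 1)) :
    Summable (fun k : {q : ℕ × ℕ // q.2 ≤ q.1 ∧ 1 ≤ q.2} =>
        ((((k.1.1 : ℝ) + k.1.2 + n + r) * ((k.1.1 : ℝ) - k.1.2 + r)) ^ e) /
          (((ascPochhammer ℝ (n + 1)).eval ((k.1.1 : ℝ) + r)) ^ A *
            ((ascPochhammer ℝ (n + 1)).eval (k.1.2 : ℝ)) ^ A)) ∧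
    ∃ (c₀ : ℚ) (c : ℕ → ℚ) (d : ℕ × ℕ → ℚ),
      (∑' k : {q : ℕ × ℕ // q.2 ≤ q.1 ∧ 1 ≤ q.2},
          ((((k.1.1 : ℝ) + k.1.2 + n + r) * ((k.1.1 : ℝ) - k.1.2 + r)) ^ e) /
            (((ascPochhammer ℝ (n + 1)).eval ((k.1.1 : ℝ) + r)) ^ A *
              ((ascPochhammer ℝ (n + 1)).eval (k.1.2 : ℝ)) ^ A))
        = c₀ + (∑ s ∈ Finset.Icc 2 (if n + 1 ≤ r then A else 2 * A), (c s : ℝ) * zv s) +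
          ∑ q ∈ (Finset.Icc 2 A ×ˢ Finset.Icc 2 A).filter
              (fun q => q.1 ≤ q.2 ∧ q.1 % 2 = (A * (n + 1)) % 2 ∧
                q.2 % 2 = (A * (n + 1)) % 2 ∧ (q.1 = q.2 → e % 2 = 0)),
            (d q : ℝ) * (dzv q.1 q.2 + (-1 : ℝ) ^ e * dzv q.2 q.1) := by
  let ε : ℕ × ℕ ≃ {q : ℕ × ℕ // q.2 ≤ q.1 ∧ 1 ≤ q.2} := offsetEquiv 0
  set S := if n + 1 ≤ r then A else 2 * A with hSdef
  have hS : (n + 1 ≤ r ∧ A ≤ S) ∨ 2 * A ≤ S := by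
    by_cases h : n + 1 ≤ r
    · exact Or.inl ⟨h, by simp [hSdef, h]⟩
    · exact Or.inr (by simp [hSdef, h])
  let f : ℕ → ℕ → ℝ := fun m k => kernelFun n A m (k + 1)
  let w : ℕ → ℚ := fun m => (-1) ^ (e - m) * e.choose m
  have hdecay : ∀ m ≤ e, DecaysLike 2 (f m) := fun m hm => decaysLike_kernelFun (by omega)
  have hexp : ∀ m ≤ e, HasParityExpansion n A (A * (n + 1)) (f m) := fun m hm =>
    kernelFun_hasParityExpansion (by omega)
  choose! P hP hPpar using fun m hm => (hexp m hm).2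
  have hterm : ∀ p : ℕ × ℕ,
      (((((ε p).1.1 : ℝ) + (ε p).1.2 + n + r) * (((ε p).1.1 : ℝ) - (ε p).1.2 + r)) ^ e) /
          (((ascPochhammer ℝ (n + 1)).eval (((ε p).1.1 : ℝ) + r)) ^ A *
            ((ascPochhammer ℝ (n + 1)).eval ((ε p).1.2 : ℝ)) ^ A) =
        ∑ m ∈ Finset.range (e + 1), (w m : ℝ) * (f m (p.2 + p.1 + r) * f (e - m) p.1) := by
    intro p
    simp only [ε, offsetEquiv, Equiv.coe_fn_mk, f, w, kernelFun, ascPochhammer_eval_eq_prod]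
    push_cast
    set x : ℝ := (p.2 : ℝ) + p.1 + r + 1 with hx
    set y : ℝ := (p.1 : ℝ) + 1 with hy
    rw [show (p.2 : ℝ) + p.1 + 1 + 0 + y + n + r = x + y + n by rw [hx]; ring,
      show (p.2 : ℝ) + p.1 + 1 + 0 - y + r = x - y by rw [hx]; ring,
      show (p.2 : ℝ) + p.1 + 1 + 0 + r = x by rw [hx]; ring,
      show (x + y + n) * (x - y) = x * (x + n) + -(y * (y + n)) by ring, add_pow,
      Finset.sum_div]
    refine Finset.sum_congr rfl fun m _ => ?_
    rw [neg_pow (y * (y + n)), div_mul_div_comm]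
    ring
  have hsum : ∀ m ∈ Finset.range (e + 1), Summable fun p : ℕ × ℕ =>
      (w m : ℝ) * (f m (p.2 + p.1 + r) * f (e - m) p.1) := fun m hm =>
    ((hdecay m (Finset.mem_range_succ_iff.mp hm)).summable_double
      (hdecay (e - m) (Nat.sub_le _ _)) r).mul_left _
  refine ⟨ε.summable_iff.mp ((summable_sum hsum).congr fun p => (hterm p).symm), ?_⟩
  rw [← ε.tsum_eq, tsum_congr hterm, Summable.tsum_finsetSum hsum]
  simp only [tsum_mul_left]
  let D : ℕ × ℕ → ℚ := fun q =>
    ∑ m ∈ Finset.range (e + 1), w m * (P m q.1 * P (e - m) q.2)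
  have hDsymm : ∀ q, D q.swap = (-1) ^ e * D q := by
    intro q
    simp only [D, Prod.fst_swap, Prod.snd_swap]
    rw [← Finset.sum_range_reflect, Finset.mul_sum]
    refine Finset.sum_congr rfl fun m hm => ?_
    rw [Finset.mem_range_succ_iff] at hm
    have h1 : e + 1 - 1 - m = e - m := by omega
    have h2 : e - (e - m) = m := by omega
    simp only [h1, h2, w, Nat.choose_symm hm]
    have h3 : (-1 : ℚ) ^ e * (-1) ^ (e - m) = (-1) ^ m := by
      rw [← pow_add, show e + (e - m) = 2 * (e - m) + m by omega, pow_add, pow_mul]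
      simp
    rw [← h3]
    ring
  have hDpar : ∀ q, q.1 % 2 ≠ (A * (n + 1)) % 2 ∨ q.2 % 2 ≠ (A * (n + 1)) % 2 → D q = 0 := by
    intro q hq
    refine Finset.sum_eq_zero fun m hm => ?_
    rcases hq with hq | hq
    · rw [hPpar m (Finset.mem_range_succ_iff.mp hm) _ hq]
      ring
    · rw [hPpar (e - m) (Nat.sub_le _ _) _ hq]
      ring
  obtain ⟨d, hd⟩ := sum_symmetric_eq (A := A) (fun q => dzv q.1 q.2) hDsymm hDpar
  have hmem : ∑ m ∈ Finset.range (e + 1), (w m : ℝ) *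
        ∑' p : ℕ × ℕ, f m (p.2 + p.1 + r) * f (e - m) p.1 -
      ∑ s ∈ Finset.Icc 2 A, ∑ t ∈ Finset.Icc 2 A, (D (s, t) : ℝ) * dzv s t ∈ zetaSpan S := by
    have hDsum : ∑ s ∈ Finset.Icc 2 A, ∑ t ∈ Finset.Icc 2 A, (D (s, t) : ℝ) * dzv s t =
        ∑ m ∈ Finset.range (e + 1), (w m : ℝ) * ∑ s ∈ Finset.Icc 2 A, ∑ t ∈ Finset.Icc 2 A,
          ((P m s * P (e - m) t : ℚ) : ℝ) * dzv s t := by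
      simp only [D, Rat.cast_sum, Finset.sum_mul, Finset.mul_sum]
      symm
      rw [Finset.sum_comm]
      refine Finset.sum_congr rfl fun s _ => ?_
      rw [Finset.sum_comm]
      refine Finset.sum_congr rfl fun m _ => Finset.sum_congr rfl fun t _ => ?_
      push_cast
      ring
    rw [hDsum, ← Finset.sum_sub_distrib]
    refine Submodule.sum_mem _ fun m hm => ?_
    rw [← mul_sub]
    have hm' := Finset.mem_range_succ_iff.mp hm
    have hm'' : e - m ≤ e := Nat.sub_le _ _
    exact rat_mul_mem_zetaSpan _ (tsum_double_mem (by omega) hS (hdecay m hm') (hdecay _ hm'')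
      (hexp _ hm'').1 ((hP m hm').drop_residue (by omega) (hdecay m hm'))
      ((hP _ hm'').drop_residue (by omega) (hdecay _ hm'')))
  obtain ⟨c₀, c, hc⟩ := exists_eq_of_mem_zetaSpan hmem
  refine ⟨c₀, c, d, ?_⟩
  rw [sub_eq_iff_eq_add] at hc
  rw [hc, hd]
  rfl
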